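/- Let p be an odd prime, k a nonzero integer, and let p^α be the exact power of p dividing k. Define G_k(p^β) = ((1-i)/2 + (-1/p^β)(1+i)/2) · Σ_{a mod p^β} (a/p^β) e(ak/p^β). Then for β ≥ 1: G_k(p^β) = 0 if β ≤ α is odd; G_k(p^β) = φ(p^β) (Euler totient) if β ≤ α is even; G_k(p^β) = (kp^{-α}/p) p^α √p if β = α+1 is odd; G_k(p^β) = -p^α if β = α+1 is even; and G_k(p^β) = 0 if β ≥ α+2. -/

import Mathlib

open Complex Finset

/-- The Gauss-type sum `G_k(n)` for odd `n`. -/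
noncomputable def gaussG (k : ℤ) (n : ℕ) : ℂ :=
  ((1 - Complex.I) / 2 + (jacobiSym (-1) n : ℂ) * (1 + Complex.I) / 2) *
    ∑ a ∈ Finset.range n, (jacobiSym (a : ℤ) n : ℂ) *
      Complex.exp (2 * Real.pi * Complex.I * ((a : ℂ) * (k : ℂ) / (n : ℂ)))

open Polynomial in
/-- The Euler operator on polynomials, sending `f` to `X` times its derivative. -/
noncomputable def eulerOp (R : Type*) [CommRing R] : R[X] →ₗ[R] R[X] :=
  LinearMap.mulLeft R X ∘ₗ derivative

open Polynomial in
lemma eulerOp_pow_monomial {R : Type*} [CommRing R] (n j : ℕ) (c : R) :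
    (eulerOp R ^ n) (C c * X ^ j) = C (c * (j : R) ^ n) * X ^ j := by
  induction n with
  | zero => simp
  | succ n ih =>
    rw [pow_succ', Module.End.mul_apply, ih]
    rcases j with _ | j
    · simp [eulerOp, -map_pow, pow_succ]
    · rw [eulerOp, LinearMap.comp_apply, derivative_C_mul_X_pow, LinearMap.mulLeft_apply,
        Nat.add_sub_cancel, pow_succ, pow_succ X j]
      simp only [C_mul]
      ring

open Polynomial in
lemma eval_one_eulerOp_pow {R : Type*} [CommRing R] (n : ℕ) (f : R[X]) :
    eval 1 ((eulerOp R ^ n) ((X - 1) ^ n * f)) = n.factorial * eval 1 f := by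
  induction n generalizing f with
  | zero => simp
  | succ n ih =>
    have h : eulerOp R ((X - 1) ^ (n + 1) * f) =
        (X - 1) ^ n * ((n + 1 : R[X]) * X * f + (X - 1) * X * derivative f) := by
      simp [eulerOp, derivative_pow]
      ring
    rw [pow_succ, Module.End.mul_apply, h, ih]
    simp [Nat.factorial_succ]
    ring

open Polynomial in
lemma eval_one_eulerOp_pow_of_aeval_eq_zero {p : ℕ} [Fact p.Prime] {ζ : ℂ}
    (hζ : IsPrimitiveRoot ζ p) {f : ℤ[X]} (hf : aeval ζ f = 0) {m : ℕ} (hm : m < p - 1) :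
    eval 1 ((eulerOp (ZMod p) ^ m) (f.map (Int.castRingHom (ZMod p)))) = 0 := by
  have hp : p.Prime := Fact.out
  have h1 : cyclotomic p ℤ ∣ f := by
    rw [cyclotomic_eq_minpoly hζ hp.pos]
    exact minpoly.isIntegrallyClosed_dvd (hζ.isIntegral hp.pos) hf
  have h2 := Polynomial.map_dvd (Int.castRingHom (ZMod p)) h1
  have h3 : cyclotomic p (ZMod p) = (X - 1) ^ (p - 1) := by
    have := cyclotomic_mul_prime_eq_pow_of_not_dvd (ZMod p) (p := p) (n := 1) hp.not_dvd_one
    simpa using this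
  rw [map_cyclotomic, h3] at h2
  obtain ⟨g, hg⟩ := h2
  obtain ⟨d, hd⟩ := Nat.exists_eq_add_of_lt hm
  rw [hg, hd, add_assoc, pow_add, mul_assoc, eval_one_eulerOp_pow]
  simp

lemma prod_range_two_mul_reflect {M : Type*} [CommMonoid M] (f : ℕ → M) (m : ℕ) :
    ∏ j ∈ range (2 * m), f j = (∏ j ∈ range m, f j) * ∏ j ∈ range m, f (2 * m - 1 - j) := by
  rw [two_mul, prod_range_add, ← prod_range_reflect (fun x => f (m + x)) m]
  congr 1
  refine prod_congr rfl fun j hj => ?_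
  congr 1
  have := mem_range.1 hj
  omega

lemma ZMod.factorial_half_sq {p m : ℕ} [Fact p.Prime] (hm : p = 2 * m + 1) :
    (m.factorial : ZMod p) ^ 2 * (-1) ^ m = -1 := by
  have hm' : p - 1 = 2 * m := by omega
  refine Eq.trans ?_ (ZMod.wilsons_lemma p)
  rw [hm', ← prod_range_add_one_eq_factorial (2 * m),
    prod_range_two_mul_reflect, ← prod_range_add_one_eq_factorial m]
  push_cast
  rw [sq, mul_assoc]
  congr 1
  conv_lhs => rw [← card_range m, ← prod_const, card_range, ← prod_mul_distrib]
  refine prod_congr rfl fun j hj => ?_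
  have := mem_range.1 hj
  have h0 : ((2 * m + 1 : ℕ) : ZMod p) = 0 := by rw [← hm]; simp
  have h1 : 2 * m + 1 = (2 * m - 1 - j + 1) + (j + 1) := by omega
  rw [h1] at h0
  push_cast at h0
  linear_combination -h0

lemma ZMod.sum_range_pow_card_sub_one (p : ℕ) [Fact p.Prime] :
    ∑ j ∈ range p, (j : ZMod p) ^ (p - 1) = -1 := by
  have hp : p.Prime := Fact.out
  obtain ⟨n, rfl⟩ : ∃ n, p = n + 1 := ⟨p - 1, by have := hp.pos; omega⟩
  have hn : n ≠ 0 := by rintro rfl; exact absurd hp (by norm_num)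
  rw [sum_range_succ']
  have : ∀ j ∈ range n, ((j + 1 : ℕ) : ZMod (n + 1)) ^ (n + 1 - 1) = 1 := by
    intro j hj
    apply ZMod.pow_card_sub_one_eq_one
    rw [Ne, ZMod.natCast_eq_zero_iff]
    exact Nat.not_dvd_of_pos_of_lt (by omega) (by simpa using hj)
  rw [sum_congr rfl this]
  have h0 : ((n + 1 : ℕ) : ZMod (n + 1)) = 0 := ZMod.natCast_self _
  push_cast at h0
  simp [hn]
  linear_combination h0

open Polynomial in
/-- The polynomial `∏ (X ^ j - X ^ (p - j))`, `1 ≤ j ≤ m`; at a primitive `p`-th root of unity with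
`p = 2 * m + 1` it is, up to sign, the quadratic Gauss sum. -/
noncomputable def halfProd (p m : ℕ) : ℤ[X] :=
  ∏ j ∈ range m, (X ^ (j + 1) - X ^ (p - (j + 1)))

open Polynomial in
lemma exists_X_pow_sub_X_pow {R : Type*} [CommRing R] (a b : ℕ) :
    ∃ c : R[X], X ^ a - X ^ b = (X - 1) * c ∧ eval 1 c = a - b := by
  refine ⟨∑ i ∈ range a, X ^ i - ∑ i ∈ range b, X ^ i, ?_, by simp [eval_finsetSum]⟩
  rw [mul_sub, mul_geom_sum, mul_geom_sum]
  ring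

open Polynomial in
lemma eval_one_eulerOp_pow_halfProd {p m : ℕ} [Fact p.Prime] (hm : p = 2 * m + 1) :
    eval 1 ((eulerOp (ZMod p) ^ m) ((halfProd p m).map (Int.castRingHom (ZMod p)))) =
      2 ^ m * (m.factorial : ZMod p) ^ 2 := by
  choose c hc hc1 using fun a b => exists_X_pow_sub_X_pow (R := ZMod p) a b
  have h : (halfProd p m).map (Int.castRingHom (ZMod p)) =
      (X - 1) ^ m * ∏ j ∈ range m, c (j + 1) (p - (j + 1)) := by
    simp [halfProd, Polynomial.map_prod, hc, prod_mul_distrib]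
  rw [h, eval_one_eulerOp_pow, eval_prod, sq, mul_left_comm]
  congr 1
  rw [← prod_range_add_one_eq_factorial]
  push_cast
  conv_rhs => rw [← card_range m, ← prod_const, card_range, ← prod_mul_distrib]
  refine prod_congr rfl fun j hj => ?_
  have := mem_range.1 hj
  rw [hc1, Nat.cast_sub (by omega), ZMod.natCast_self]
  push_cast
  ring

open Polynomial in
/-- The polynomial `∑ (j / p) X ^ j`. -/
noncomputable def legendrePoly (p : ℕ) : ℤ[X] :=
  ∑ j ∈ range p, C (jacobiSym j p) * X ^ j

open Polynomial in
lemma eval_one_eulerOp_pow_legendrePoly {p m : ℕ} [Fact p.Prime] (hm : p = 2 * m + 1) :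
    eval 1 ((eulerOp (ZMod p) ^ m) ((legendrePoly p).map (Int.castRingHom (ZMod p)))) = -1 := by
  have hm' : p / 2 = m := by omega
  have hm'' : p - 1 = m + m := by omega
  rw [← ZMod.sum_range_pow_card_sub_one p, legendrePoly, Polynomial.map_sum, map_sum,
    eval_finsetSum]
  refine sum_congr rfl fun j _ => ?_
  rw [Polynomial.map_mul, Polynomial.map_pow, map_X, map_C, eulerOp_pow_monomial,
    ← jacobiSym.legendreSym.to_jacobiSym, eq_intCast, legendreSym.eq_pow, hm', hm'', pow_add]
  simp

lemma ZMod.two_pow_half_eq_χ₈ {p m : ℕ} [Fact p.Prime] (hm : p = 2 * m + 1) :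
    (2 : ZMod p) ^ m = (ZMod.χ₈ p : ℤ) := by
  have hm' : p / 2 = m := by omega
  rw [← legendreSym.at_two (by omega), legendreSym.eq_pow, hm']
  simp

open Polynomial in
lemma aeval_legendrePoly_sq {p m : ℕ} [Fact p.Prime] (hm : p = 2 * m + 1) {ζ : ℂ}
    (hζ : IsPrimitiveRoot ζ p) : (aeval ζ (legendrePoly p)) ^ 2 = (-1) ^ m * p := by
  have hp : p.Prime := Fact.out
  have hp2 : ringChar (ZMod p) ≠ 2 := by rw [ZMod.ringChar_zmod_n]; omega
  set χ : MulChar (ZMod p) ℂ := (quadraticChar (ZMod p)).ringHomComp (Int.castRingHom ℂ) with hχ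
  have h1 : χ ≠ 1 := by
    rw [hχ, MulChar.ringHomComp_ne_one_iff Int.cast_injective]
    exact quadraticChar_ne_one hp2
  have h2 : χ.IsQuadratic := (quadraticChar_isQuadratic (ZMod p)).comp _
  have h3 := gaussSum_sq h1 h2 (AddChar.zmodChar_primitive_of_primitive_root p hζ)
  have h4 : χ (-1) = (-1) ^ m := by
    have hm' : p / 2 = m := by omega
    rw [hχ, MulChar.ringHomComp_apply, quadraticChar_neg_one hp2, ZMod.card,
      ZMod.χ₄_eq_neg_one_pow (by omega), hm']
    simp
  rw [h4, ZMod.card] at h3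
  rw [← h3]
  congr 1
  rw [gaussSum, legendrePoly, map_sum]
  refine sum_bij' (fun j _ => (j : ZMod p)) (fun a _ => a.val) (by simp)
    (fun a _ => by simpa using ZMod.val_lt a) (fun j hj => ZMod.val_cast_of_lt (by simpa using hj))
    (by simp) fun j hj => ?_
  rw [AddChar.zmodChar_apply', ← jacobiSym.legendreSym.to_jacobiSym, legendreSym, hχ,
    MulChar.ringHomComp_apply]
  simp

open Polynomial in
lemma norm_aeval_halfProd {p m : ℕ} (hm : p = 2 * m + 1) {ζ : ℂ} (hζ : IsPrimitiveRoot ζ p) :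
    ‖aeval ζ (halfProd p m)‖ = √p := by
  have hn : ‖ζ‖ = 1 := hζ.norm'_eq_one (by omega)
  have key : ∀ j < 2 * m, ‖ζ ^ (j + 1) - ζ ^ (p - (j + 1))‖ = ‖1 - (ζ ^ 2) ^ (j + 1)‖ := by
    intro j hj
    have h : ζ ^ (j + 1) * (ζ ^ (j + 1) - ζ ^ (p - (j + 1))) = -(1 - (ζ ^ 2) ^ (j + 1)) := by
      rw [mul_sub, ← pow_add, ← pow_add, Nat.add_sub_cancel' (by omega), hζ.pow_eq_one]
      ring
    have := congrArg norm h
    simpa only [norm_mul, norm_pow, hn, one_pow, one_mul, norm_neg] using this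
  have h2 : IsPrimitiveRoot (ζ ^ 2) (2 * m + 1) := by
    rw [hm] at hζ
    exact hζ.pow_of_coprime 2 (by simp)
  have h3 := congrArg norm h2.prod_one_sub_pow_eq_order
  have h4 : ‖aeval ζ (halfProd p m)‖ ^ 2 = p := by
    have h5 : ‖(((2 * m : ℕ) : ℂ) + 1)‖ = p := by
      rw [← Nat.cast_succ, Complex.norm_natCast, hm]
    rw [← h5, ← h3, norm_prod, prod_range_two_mul_reflect, sq, halfProd, map_prod, norm_prod]
    congr 1
    · refine prod_congr rfl fun j hj => ?_
      have := mem_range.1 hj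
      rw [← key j (by omega)]
      simp
    · refine prod_congr rfl fun j hj => ?_
      have := mem_range.1 hj
      rw [← key _ (by omega), ← norm_neg, show p - (2 * m - 1 - j + 1) = j + 1 by omega,
        show 2 * m - 1 - j + 1 = p - (j + 1) by omega]
      simp
  rw [← h4, Real.sqrt_sq (norm_nonneg _)]

open Polynomial in
lemma aeval_halfProd {p m : ℕ} (hm : p = 2 * m + 1) :
    aeval (exp (2 * Real.pi * I / p)) (halfProd p m) = I ^ m * (√p : ℂ) := by
  have hp0 : (p : ℂ) ≠ 0 := by norm_cast; omega
  have hpr : (0 : ℝ) < p := by norm_cast; omega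
  have hζ := Complex.isPrimitiveRoot_exp p (by omega)
  have h : aeval (exp (2 * Real.pi * I / p)) (halfProd p m) =
      I ^ m * ((∏ j ∈ range m, 2 * Real.sin (2 * Real.pi * (j + 1) / p) : ℝ) : ℂ) := by
    rw [halfProd, map_prod]
    push_cast
    conv_rhs => rw [← card_range m, ← prod_const, card_range, ← prod_mul_distrib]
    refine prod_congr rfl fun j hj => ?_
    have hj' := mem_range.1 hj
    have e1 : exp (2 * Real.pi * I / p) ^ (j + 1) = exp ((2 * Real.pi * (j + 1) / p) * I) := by
      rw [← exp_nat_mul]; congr 1; push_cast; ring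
    have e2 : exp (2 * Real.pi * I / p) ^ (p - (j + 1)) =
        exp (-(2 * Real.pi * (j + 1) / p) * I) := by
      rw [← mul_right_inj' (exp_ne_zero ((2 * Real.pi * (j + 1) / p) * I)), ← exp_add, ← e1,
        ← pow_add, Nat.add_sub_cancel' (by omega), hζ.pow_eq_one]
      simp
    rw [map_sub, map_pow, map_pow, aeval_X, e1, e2, exp_mul_I, exp_mul_I, Complex.cos_neg,
      Complex.sin_neg]
    ring
  have hpos : 0 ≤ ∏ j ∈ range m, 2 * Real.sin (2 * Real.pi * (j + 1) / p) := by
    refine prod_nonneg fun j hj => mul_nonneg (by norm_num) ?_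
    have hj' : 2 * ((j : ℝ) + 1) ≤ p := by
      have := mem_range.1 hj
      norm_cast; omega
    refine Real.sin_nonneg_of_nonneg_of_le_pi (by positivity) ?_
    rw [div_le_iff₀ hpr]
    nlinarith [Real.pi_pos]
  have hn := norm_aeval_halfProd hm hζ
  rw [h, norm_mul, norm_pow, norm_I, one_pow, one_mul, Complex.norm_real, Real.norm_of_nonneg hpos]
    at hn
  rw [h, hn]

open Polynomial in
/-- Gauss's evaluation of the quadratic Gauss sum. -/
lemma aeval_legendrePoly {p : ℕ} [Fact p.Prime] (hodd : Odd p) :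
    aeval (exp (2 * Real.pi * I / p)) (legendrePoly p) =
      if p % 4 = 1 then (√p : ℂ) else I * (√p : ℂ) := by
  obtain ⟨m, hm⟩ := hodd
  have hp : p.Prime := Fact.out
  have h0 : m ≠ 0 := by rintro rfl; exact hp.one_lt.ne' hm
  have hζ := Complex.isPrimitiveRoot_exp p hp.ne_zero
  have hB := aeval_halfProd hm
  have hsq : ((√p : ℝ) : ℂ) ^ 2 = p := by
    rw [← ofReal_pow, Real.sq_sqrt (Nat.cast_nonneg p), ofReal_natCast]
  have hAB : ∃ ε : ℤ, (ε = 1 ∨ ε = -1) ∧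
      aeval (exp (2 * Real.pi * I / p)) (legendrePoly p - C ε * halfProd p m) = 0 := by
    have h : (aeval (exp (2 * Real.pi * I / p)) (legendrePoly p)) ^ 2 =
        (aeval (exp (2 * Real.pi * I / p)) (halfProd p m)) ^ 2 := by
      rw [aeval_legendrePoly_sq hm hζ, hB, mul_pow, hsq, ← pow_mul, mul_comm m, pow_mul, I_sq]
    rcases sq_eq_sq_iff_eq_or_eq_neg.1 h with h | h
    · exact ⟨1, by simp, by simp [h]⟩
    · exact ⟨-1, by simp, by simp [h]⟩
  obtain ⟨ε, hε, hAB⟩ := hAB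
  have hmod := eval_one_eulerOp_pow_of_aeval_eq_zero hζ hAB (m := m) (by omega)
  rw [Polynomial.map_sub, Polynomial.map_mul, map_C, ← smul_eq_C_mul, map_sub, map_smul, eval_sub,
    eval_smul, eval_one_eulerOp_pow_legendrePoly hm, eval_one_eulerOp_pow_halfProd hm,
    ZMod.two_pow_half_eq_χ₈ hm] at hmod
  have hε' : ((ε * ZMod.χ₈ p - (-1) ^ m : ℤ) : ZMod p) = 0 := by
    have hw := ZMod.factorial_half_sq hm
    simp only [eq_intCast, smul_eq_mul] at hmod
    push_cast
    linear_combination (-1) ^ m * hmod + (ε * (ZMod.χ₈ p : ℤ) : ZMod p) * hw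
  rw [ZMod.intCast_zmod_eq_zero_iff_dvd] at hε'
  have hA : aeval (exp (2 * Real.pi * I / p)) (legendrePoly p) = ε * (I ^ m * (√p : ℂ)) := by
    rw [← hB, ← sub_eq_zero, ← hAB]
    simp
  rw [hA, ← mul_assoc]
  have hχ := ZMod.χ₈_nat_eq_if_mod_eight p
  have hε'' : ε * ZMod.χ₈ p - (-1) ^ m = 0 := by
    refine Int.eq_zero_of_abs_lt_dvd hε' ?_
    have h3 : ε * ZMod.χ₈ p = 1 ∨ ε * ZMod.χ₈ p = -1 := by
      rw [hχ, if_neg (by omega)]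
      rcases hε with rfl | rfl <;> split_ifs <;> simp
    have h4 := neg_one_pow_eq_or ℤ m
    rcases h3 with h3 | h3 <;> rcases h4 with h4 | h4 <;> rw [h3, h4] <;> norm_num <;> omega
  rw [hχ, if_neg (by omega)] at hε''
  obtain ⟨k, r, hr, hk⟩ : ∃ k r, r < 4 ∧ m = 4 * k + r :=
    ⟨m / 4, m % 4, Nat.mod_lt _ (by norm_num), (Nat.div_add_mod m 4).symm⟩
  have hI : I ^ m = I ^ r := by rw [hk, pow_add, pow_mul, I_pow_four, one_pow, one_mul]
  have hs : (-1 : ℤ) ^ m = (-1) ^ r := by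
    rw [hk, pow_add, pow_mul, show (-1 : ℤ) ^ 4 = 1 by norm_num, one_pow, one_mul]
  rw [hI]
  rw [hs] at hε''
  have hp8 : p % 8 = 2 * r + 1 := by omega
  have hp4 : p % 4 = (2 * r + 1) % 4 := by omega
  rw [hp8] at hε''
  rw [hp4]
  interval_cases r
  · have : ε = 1 := by norm_num at hε''; omega
    simp [this]
  · have : ε = 1 := by norm_num at hε''; omega
    simp [this]
  · have : ε = -1 := by norm_num at hε''; omega
    simp [this]
  · have : ε = -1 := by norm_num at hε''; omega
    simp [this, pow_succ]

lemma sum_range_mul_eq_sum_sum {M : Type*} [AddCommMonoid M] (f : ℕ → M) (p N : ℕ) :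
    ∑ a ∈ range (p * N), f a = ∑ q ∈ range N, ∑ r ∈ range p, f (p * q + r) := by
  induction N with
  | zero => simp
  | succ N ih => rw [mul_add_one, sum_range_add, ih, sum_range_succ]

lemma sum_range_exp_two_pi_mul_div {N : ℕ} (hN : N ≠ 0) (k : ℤ) :
    ∑ q ∈ range N, exp (2 * Real.pi * I * ((q : ℂ) * k / N)) =
      if (N : ℤ) ∣ k then (N : ℂ) else 0 := by
  have hN' : (N : ℂ) ≠ 0 := Nat.cast_ne_zero.2 hN
  have h : ∀ q : ℕ, exp (2 * Real.pi * I * ((q : ℂ) * k / N)) =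
      exp (2 * Real.pi * I * (k / N)) ^ q := fun q => by
    rw [← exp_nat_mul]; congr 1; ring
  simp only [h]
  split_ifs with hk
  · obtain ⟨c, rfl⟩ := hk
    have : exp (2 * Real.pi * I * (((N * c : ℤ) : ℂ) / N)) = 1 := by
      rw [exp_eq_one_iff]
      exact ⟨c, by push_cast; field_simp⟩
    simp only [this, one_pow, sum_const, card_range, nsmul_one]
  · have h1 : exp (2 * Real.pi * I * (k / N)) ≠ 1 := by
      rw [Ne, exp_eq_one_iff]
      rintro ⟨c, hc⟩
      refine hk ⟨c, ?_⟩
      have h2 : (k : ℂ) / N = c := by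
        rw [mul_comm] at hc
        exact mul_right_cancel₀ two_pi_I_ne_zero hc
      rw [div_eq_iff hN'] at h2
      rw [mul_comm]
      exact_mod_cast h2
    rw [geom_sum_eq h1, ← exp_nat_mul, exp_eq_one_iff.2 ⟨k, by field_simp⟩]
    simp

lemma sum_range_periodic_mul_exp {p γ : ℕ} (hp : p ≠ 0) {f : ℕ → ℂ}
    (hf : ∀ q r, f (p * q + r) = f r) (k : ℤ) :
    ∑ a ∈ range (p ^ (γ + 1)), f a * exp (2 * Real.pi * I * ((a : ℂ) * k / (p ^ (γ + 1) : ℕ))) =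
      (if ((p ^ γ : ℕ) : ℤ) ∣ k then ((p ^ γ : ℕ) : ℂ) else 0) *
        ∑ r ∈ range p, f r * exp (2 * Real.pi * I * ((r : ℂ) * k / (p ^ (γ + 1) : ℕ))) := by
  have hp' : (p : ℂ) ≠ 0 := Nat.cast_ne_zero.2 hp
  rw [← sum_range_exp_two_pi_mul_div (pow_ne_zero _ hp), sum_mul_sum, pow_succ',
    sum_range_mul_eq_sum_sum]
  refine sum_congr rfl fun q _ => sum_congr rfl fun r _ => ?_
  rw [hf, mul_left_comm, ← exp_add]
  congr 2
  push_cast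
  field_simp

lemma jacobiSym_pow_periodic (p β q r : ℕ) :
    jacobiSym ((p * q + r : ℕ) : ℤ) (p ^ β) = jacobiSym r (p ^ β) := by
  rw [jacobiSym.pow_right, jacobiSym.pow_right]
  congr 1
  apply jacobiSym.mod_left'
  push_cast
  simp

lemma sum_jacobiSym_mul_exp_prime_pow {p : ℕ} (hp : p ≠ 0) (β γ : ℕ) (hβ : β = γ + 1) (k : ℤ) :
    ∑ a ∈ range (p ^ β), (jacobiSym (a : ℤ) (p ^ β) : ℂ) *
      exp (2 * Real.pi * I * ((a : ℂ) * k / (p ^ β : ℕ))) =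
      (if (p : ℤ) ^ γ ∣ k then (p : ℂ) ^ γ else 0) *
        ∑ r ∈ range p, (jacobiSym (r : ℤ) p : ℂ) ^ β *
          exp (2 * Real.pi * I * ((r : ℂ) * (k / (p : ℤ) ^ γ : ℤ) / p)) := by
  subst hβ
  have hp' : (p : ℂ) ≠ 0 := Nat.cast_ne_zero.2 hp
  have hpz : (p : ℤ) ^ γ ≠ 0 := pow_ne_zero _ (Nat.cast_ne_zero.2 hp)
  rw [sum_range_periodic_mul_exp hp (f := fun a => (jacobiSym (a : ℤ) (p ^ (γ + 1)) : ℂ))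
    (fun q r => by rw [jacobiSym_pow_periodic])]
  push_cast
  split_ifs with h
  · obtain ⟨c, rfl⟩ := h
    rw [Int.mul_ediv_cancel_left _ hpz]
    congr 1
    refine sum_congr rfl fun r _ => ?_
    rw [jacobiSym.pow_right]
    push_cast
    congr 3
    field_simp
    ring
  · simp

lemma sum_jacobiSym_mul_exp {p : ℕ} [Fact p.Prime] (hodd : Odd p) {k : ℤ} (hk : ¬ (p : ℤ) ∣ k) :
    ∑ r ∈ range p, (jacobiSym (r : ℤ) p : ℂ) * exp (2 * Real.pi * I * ((r : ℂ) * k / p)) =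
      jacobiSym k p * if p % 4 = 1 then (√p : ℂ) else I * (√p : ℂ) := by
  set χ : MulChar (ZMod p) ℂ := (quadraticChar (ZMod p)).ringHomComp (Int.castRingHom ℂ) with hχ
  have hχJ : ∀ a : ℤ, χ (a : ZMod p) = jacobiSym a p := fun a => by
    rw [← jacobiSym.legendreSym.to_jacobiSym, legendreSym, hχ, MulChar.ringHomComp_apply]
    simp
  have key : ∀ l : ℤ, ∑ r ∈ range p,
      (jacobiSym (r : ℤ) p : ℂ) * exp (2 * Real.pi * I * ((r : ℂ) * l / p)) =
      gaussSum χ ((ZMod.stdAddChar (N := p)).mulShift l) := fun l => by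
    rw [gaussSum]
    refine sum_bij' (fun j _ => (j : ZMod p)) (fun a _ => a.val) (by simp)
      (fun a _ => by simpa using ZMod.val_lt a)
      (fun j hj => ZMod.val_cast_of_lt (by simpa using hj)) (by simp) fun j hj => ?_
    have h := hχJ j
    rw [Int.cast_natCast] at h
    have h' : (l : ZMod p) * (j : ZMod p) = ((l * j : ℤ) : ZMod p) := by push_cast; rfl
    rw [h, AddChar.mulShift_apply, h', ZMod.stdAddChar_coe]
    congr 2
    push_cast
    ring
  have h1 : gaussSum χ ZMod.stdAddChar = if p % 4 = 1 then (√p : ℂ) else I * (√p : ℂ) := by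
    have h := key 1
    rw [Int.cast_one, Int.cast_one, AddChar.mulShift_one] at h
    rw [← h, ← aeval_legendrePoly hodd, legendrePoly, map_sum]
    refine sum_congr rfl fun j _ => ?_
    rw [map_mul, map_pow, Polynomial.aeval_X, Polynomial.aeval_C, ← exp_nat_mul]
    simp only [eq_intCast]
    congr 2
    ring
  have hk' : (k : ZMod p) ≠ 0 := by rwa [Ne, ZMod.intCast_zmod_eq_zero_iff_dvd]
  have h2 := gaussSum_mulShift χ ZMod.stdAddChar (Units.mk0 _ hk')
  rw [Units.val_mk0, hχJ, h1] at h2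
  rw [key, ← h2, ← mul_assoc, ← Int.cast_mul, ← jacobiSym.legendreSym.to_jacobiSym, ← sq,
    legendreSym.sq_one p hk', Int.cast_one, one_mul]

lemma jacobiSym_natCast_pow_even {p r β : ℕ} [Fact p.Prime] (hr : r < p) (hβ : β ≠ 0)
    (he : Even β) : (jacobiSym (r : ℤ) p : ℂ) ^ β = if r = 0 then 0 else 1 := by
  have hp : p.Prime := Fact.out
  split_ifs with h
  · rw [h, Nat.cast_zero, jacobiSym.zero_left hp.one_lt, Int.cast_zero, zero_pow hβ]
  · obtain ⟨c, rfl⟩ := he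
    have hr' : ((r : ℤ) : ZMod p) ≠ 0 := by
      rw [Int.cast_natCast, Ne, ZMod.natCast_eq_zero_iff]
      exact Nat.not_dvd_of_pos_of_lt (Nat.pos_of_ne_zero h) hr
    rw [← two_mul, pow_mul, ← jacobiSym.legendreSym.to_jacobiSym, ← Int.cast_pow,
      legendreSym.sq_one p hr']
    simp

lemma jacobiSym_pow_odd {p β : ℕ} [Fact p.Prime] (ho : Odd β) (a : ℤ) :
    jacobiSym a p ^ β = jacobiSym a p := by
  rcases jacobiSym.trichotomy a p with h | h | h <;> rw [h]
  · exact zero_pow ho.pos.ne'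
  · exact one_pow β
  · exact ho.neg_one_pow

lemma exp_two_pi_mul_div_of_dvd {p : ℕ} (hp : p ≠ 0) {k : ℤ} (hk : (p : ℤ) ∣ k) (r : ℕ) :
    exp (2 * Real.pi * I * ((r : ℂ) * k / p)) = 1 := by
  obtain ⟨c, rfl⟩ := hk
  have hp' : (p : ℂ) ≠ 0 := Nat.cast_ne_zero.2 hp
  rw [exp_eq_one_iff]
  exact ⟨r * c, by push_cast; field_simp⟩

lemma sum_jacobiSym_pow_mul_exp_even {p β : ℕ} [Fact p.Prime] (hβ : β ≠ 0) (he : Even β) (k : ℤ) :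
    ∑ r ∈ range p, (jacobiSym (r : ℤ) p : ℂ) ^ β * exp (2 * Real.pi * I * ((r : ℂ) * k / p)) =
      (if (p : ℤ) ∣ k then (p : ℂ) else 0) - 1 := by
  have hp : p.Prime := Fact.out
  rw [← sum_range_exp_two_pi_mul_div hp.ne_zero, eq_sub_iff_add_eq]
  have h : ∑ r ∈ range p, (if r = 0 then (1 : ℂ) else 0) = 1 := by
    simp [hp.pos]
  rw [← h, ← sum_add_distrib]
  refine sum_congr rfl fun r hr => ?_
  rw [jacobiSym_natCast_pow_even (mem_range.1 hr) hβ he]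
  split_ifs with h0
  · simp [h0]
  · simp

lemma sum_jacobiSym_range {p : ℕ} [Fact p.Prime] (hodd : Odd p) :
    ∑ r ∈ range p, (jacobiSym (r : ℤ) p : ℂ) = 0 := by
  have hp2 : ringChar (ZMod p) ≠ 2 := by
    rw [ZMod.ringChar_zmod_n]; rintro rfl; exact absurd hodd (by decide)
  have h := quadraticChar_sum_zero hp2
  have h' : ∑ r ∈ range p, jacobiSym (r : ℤ) p = ∑ a : ZMod p, quadraticChar (ZMod p) a := by
    refine sum_bij' (fun j _ => (j : ZMod p)) (fun a _ => a.val) (by simp)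
      (fun a _ => by simpa using ZMod.val_lt a)
      (fun j hj => ZMod.val_cast_of_lt (by simpa using hj)) (by simp) fun j hj => ?_
    rw [← jacobiSym.legendreSym.to_jacobiSym, legendreSym, Int.cast_natCast]
  rw [← Int.cast_sum, h', h, Int.cast_zero]

theorem gaussG_prime_power (p : ℕ) (hp : p.Prime) (hpodd : Odd p) (k : ℤ) (hk : k ≠ 0)
    (α : ℕ) (hα : (p : ℤ) ^ α ∣ k ∧ ¬ (p : ℤ) ^ (α + 1) ∣ k) (β : ℕ) (hβ : 1 ≤ β) :
    (β ≤ α → Odd β → gaussG k (p ^ β) = 0) ∧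
    (β ≤ α → Even β → gaussG k (p ^ β) = (Nat.totient (p ^ β) : ℂ)) ∧
    (β = α + 1 → Odd β →
      gaussG k (p ^ β) = (jacobiSym (k / (p : ℤ) ^ α) p : ℂ) * (p : ℂ) ^ α * (Real.sqrt p : ℂ)) ∧
    (β = α + 1 → Even β → gaussG k (p ^ β) = -(p : ℂ) ^ α) ∧
    (α + 2 ≤ β → gaussG k (p ^ β) = 0) := by
  have : Fact p.Prime := ⟨hp⟩
  obtain ⟨γ, rfl⟩ : ∃ γ, β = γ + 1 := ⟨β - 1, by omega⟩
  obtain ⟨hα1, hα2⟩ := hα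
  have hpz : (p : ℤ) ^ γ ≠ 0 := pow_ne_zero _ (Nat.cast_ne_zero.2 hp.ne_zero)
  have hdvd : ∀ n, n ≤ α → (p : ℤ) ^ n ∣ k := fun n hn => (pow_dvd_pow _ hn).trans hα1
  have hfactor : Even (γ + 1) →
      (1 - I) / 2 + (jacobiSym (-1) (p ^ (γ + 1)) : ℂ) * (1 + I) / 2 = 1 := fun he => by
    rw [jacobiSym.pow_right, jacobiSym.at_neg_one hpodd, ZMod.χ₄_eq_neg_one_pow
      (Nat.odd_iff.1 hpodd), pow_right_comm, he.neg_one_pow, one_pow]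
    push_cast
    ring
  have hquot : γ + 1 ≤ α → (p : ℤ) ∣ k / (p : ℤ) ^ γ := fun h => by
    obtain ⟨c, rfl⟩ := hdvd _ h
    rw [pow_succ, mul_assoc, Int.mul_ediv_cancel_left _ hpz]
    exact dvd_mul_right _ _
  have hquot' : γ = α → ¬ (p : ℤ) ∣ k / (p : ℤ) ^ γ := fun h => by
    subst h
    obtain ⟨c, rfl⟩ := hα1
    rw [Int.mul_ediv_cancel_left _ hpz]
    rwa [pow_succ, mul_dvd_mul_iff_left hpz] at hα2
  refine ⟨fun h ho => ?_, fun h he => ?_, fun h ho => ?_, fun h he => ?_, fun h => ?_⟩ <;>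
    rw [gaussG, sum_jacobiSym_mul_exp_prime_pow hp.ne_zero _ γ rfl]
  · have h1 : ∀ r ∈ range p, (jacobiSym (r : ℤ) p : ℂ) ^ (γ + 1) *
        exp (2 * Real.pi * I * ((r : ℂ) * (k / (p : ℤ) ^ γ : ℤ) / p)) = jacobiSym (r : ℤ) p := by
      intro r _
      rw [exp_two_pi_mul_div_of_dvd hp.ne_zero (hquot h), mul_one, ← Int.cast_pow,
        jacobiSym_pow_odd ho]
    rw [sum_congr rfl h1, sum_jacobiSym_range hpodd, mul_zero, mul_zero]
  · rw [hfactor he, sum_jacobiSym_pow_mul_exp_even (by omega) he, if_pos (hdvd _ (by omega)),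
      if_pos (hquot h), Nat.totient_prime_pow_succ hp, Nat.cast_mul, Nat.cast_sub hp.one_le]
    simp
  · have hγ : γ = α := by omega
    have h1 : ∀ r ∈ range p, (jacobiSym (r : ℤ) p : ℂ) ^ (γ + 1) *
        exp (2 * Real.pi * I * ((r : ℂ) * (k / (p : ℤ) ^ γ : ℤ) / p)) =
        jacobiSym (r : ℤ) p * exp (2 * Real.pi * I * ((r : ℂ) * (k / (p : ℤ) ^ γ : ℤ) / p)) := by
      intro r _
      rw [← Int.cast_pow, jacobiSym_pow_odd ho]
    rw [sum_congr rfl h1, sum_jacobiSym_mul_exp hpodd (hquot' hγ), if_pos (hdvd _ hγ.le),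
      jacobiSym.pow_right, jacobiSym_pow_odd ho, jacobiSym.at_neg_one hpodd, hγ]
    have h2 := Nat.odd_iff.1 hpodd
    have h4 : p % 4 = 1 ∨ p % 4 = 3 := by omega
    rcases h4 with h4 | h4
    · rw [ZMod.χ₄_nat_one_mod_four h4, if_pos h4]
      push_cast
      ring
    · rw [ZMod.χ₄_nat_three_mod_four h4, if_neg (by omega)]
      push_cast
      linear_combination (-(jacobiSym (k / (p : ℤ) ^ α) p : ℂ) * (p : ℂ) ^ α * (√p : ℂ)) * I_sq
  · rw [hfactor he, sum_jacobiSym_pow_mul_exp_even (by omega) he, if_pos (hdvd _ (by omega)),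
      if_neg (hquot' (by omega)), show γ = α by omega]
    ring
  · rw [if_neg fun h' => hα2 ((pow_dvd_pow _ (by omega)).trans h'), zero_mul, mul_zero]
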